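/- Let G be a finite simple chordal bipartite graph and let s, t be nonadjacent distinct vertices of G. Then every minimal (s,t)-vertex separator S of G is such that the subgraph of G induced on S is either an independent set (contains no edge) or a connected subgraph. -/

import Mathlib

open SimpleGraph

/-- A walk avoids a set `S` if none of its vertices lies in `S`. -/
def WalkAvoids {V : Type*} {G : SimpleGraph V} {u v : V} (p : G.Walk u v) (S : Set V) : Prop :=
  ∀ w ∈ p.support, w ∉ S

/-- `S` is an `(s,t)`-vertex separator: `s, t ∉ S` and every walk from `s` to `t` meets `S`. -/
def IsSep {V : Type*} (G : SimpleGraph V) (s t : V) (S : Set V) : Prop :=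
  s ∉ S ∧ t ∉ S ∧ ∀ p : G.Walk s t, ∃ w ∈ p.support, w ∈ S

/-- A connected `(s,t)`-vertex separator. -/
def IsConnSep {V : Type*} (G : SimpleGraph V) (s t : V) (S : Set V) : Prop :=
  IsSep G s t S ∧ (G.induce S).Connected

/-- A minimal `(s,t)`-vertex separator: no proper subset is a separator. -/
def IsMinimalSep {V : Type*} (G : SimpleGraph V) (s t : V) (S : Set V) : Prop :=
  IsSep G s t S ∧ ∀ S' ⊂ S, ¬ IsSep G s t S'

/-- The connected component of `s` in `G − S`, as the set of vertices reachable
from `s` by walks avoiding `S`. -/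
def CompOf {V : Type*} (G : SimpleGraph V) (S : Set V) (s : V) : Set V :=
  {v | ∃ p : G.Walk s v, WalkAvoids p S}

/-- `G` has chordality at most `c`: it contains no induced cycle of length at least `c+1`. -/
def ChordalityAtMost {V : Type*} (G : SimpleGraph V) (c : ℕ) : Prop :=
  ∀ n, c + 1 ≤ n → IsEmpty (cycleGraph n ↪g G)


/-- Two vertices joined through a set `C`: an induced path with interior in `C`. -/
theorem induced_path_aux {V : Type*} (G H : SimpleGraph V) (C : Set V) (x y : V)
    (hH : ∀ a b, H.Adj a b ↔ G.Adj a b ∧ (a ∈ C ∨ a = x ∨ a = y) ∧ (b ∈ C ∨ b = x ∨ b = y))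
    (hxy : x ≠ y) (hr : H.Reachable x y) :
    ∃ (p : ℕ) (f : ℕ → V), f 0 = x ∧ f p = y ∧ (∀ i, 0 < i → i < p → f i ∈ C) ∧
      (∀ i j, i < j → j ≤ p → (G.Adj (f i) (f j) ↔ j = i + 1) ∧ f i ≠ f j) := by
  obtain ⟨w, hw⟩ := hr.exists_walk_length_eq_dist
  have hd : ∀ i, i ≤ w.length → H.dist x (w.getVert i) = i := by
    intro i hi
    have h1 : H.dist x (w.getVert i) ≤ i := by
      refine (dist_le (w.take i)).trans ?_
      simp
    have h2 : H.dist (w.getVert i) y ≤ w.length - i := by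
      refine (dist_le (w.drop i)).trans ?_
      simp
    have h3 := (w.take i).reachable.dist_triangle_left y
    omega
  have h0 : w.getVert 0 = x := by simp
  have hp : w.getVert w.length = y := by simp
  have hinj : ∀ i j, i ≤ w.length → j ≤ w.length → w.getVert i = w.getVert j → i = j := by
    intro i j hi hj h
    rw [← hd i hi, ← hd j hj, h]
  have hmem : ∀ i, i ≤ w.length → (w.getVert i ∈ C ∨ w.getVert i = x ∨ w.getVert i = y) := by
    intro i hi
    rcases Nat.lt_or_ge i w.length with h | h
    · exact ((hH _ _).1 (w.adj_getVert_succ h)).2.1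
    · have : i = w.length := by omega
      subst this; simp
  refine ⟨w.length, w.getVert, h0, hp, ?_, ?_⟩
  · intro i h1 h2
    rcases hmem i h2.le with h | h | h
    · exact h
    · have := hinj i 0 h2.le (Nat.zero_le _) (by rw [h, h0]); omega
    · have := hinj i w.length h2.le le_rfl (by rw [h, hp]); omega
  · intro i j hij hj
    refine ⟨⟨fun h => ?_, ?_⟩, fun h => ?_⟩
    · have hA : H.Adj (w.getVert i) (w.getVert j) :=
        (hH _ _).2 ⟨h, hmem i (by omega), hmem j hj⟩
      have h3 := (w.take i).reachable.dist_triangle_left (w.getVert j)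
      rw [hd i (by omega), hd j hj, dist_eq_one_iff_adj.2 hA] at h3
      omega
    · rintro rfl
      exact ((hH _ _).1 (w.adj_getVert_succ (by omega))).1
    · have := hinj i j (by omega) hj h; omega

theorem comp_step {V : Type*} {G : SimpleGraph V} {S : Set V} {s u v : V}
    (hu : u ∈ CompOf G S s) (h : G.Adj u v) (hv : v ∉ S) : v ∈ CompOf G S s := by
  obtain ⟨p, hp⟩ := hu
  refine ⟨p.concat h, ?_⟩
  intro w hw
  rw [Walk.support_concat] at hw
  simp only [List.concat_eq_append, List.mem_append, List.mem_singleton] at hw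
  rcases hw with hw | rfl
  · exact hp w hw
  · exact hv

theorem comp_notMem {V : Type*} {G : SimpleGraph V} {S : Set V} {s u : V}
    (hu : u ∈ CompOf G S s) : u ∉ S := by
  obtain ⟨p, hp⟩ := hu
  exact hp u p.end_mem_support

theorem comp_reach_aux {V : Type*} {G H : SimpleGraph V} {S : Set V} {s : V}
    (hH : ∀ a b, a ∈ CompOf G S s → b ∈ CompOf G S s → G.Adj a b → H.Adj a b)
    {u v : V} (p : G.Walk u v) : WalkAvoids p S → u ∈ CompOf G S s → H.Reachable u v := by
  induction p with
  | nil => intro _ _; exact Reachable.refl _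
  | cons h p ih =>
    intro ha hu
    have hv := comp_step hu h (ha _ (by simp))
    exact (hH _ _ hu hv h).reachable.trans (ih (fun w hw => ha w (by simp [hw])) hv)

theorem comp_reach {V : Type*} {G H : SimpleGraph V} {S : Set V} {s : V} (hs : s ∉ S)
    (hH : ∀ a b, a ∈ CompOf G S s → b ∈ CompOf G S s → G.Adj a b → H.Adj a b)
    {v : V} (hv : v ∈ CompOf G S s) : H.Reachable s v := by
  obtain ⟨p, hp⟩ := hv
  exact comp_reach_aux hH p hp ⟨Walk.nil, by intro w hw; simp at hw; subst hw; exact hs⟩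

theorem sep_full_aux {V : Type*} {G : SimpleGraph V} {S : Set V} {s x : V}
    (hx : ∀ a ∈ CompOf G S s, ¬ G.Adj a x) {u v : V} (p : G.Walk u v) :
    (∀ w ∈ p.support, w ∉ S \ {x}) → u ∈ CompOf G S s → v ∈ CompOf G S s := by
  induction p with
  | nil => intro _ h; exact h
  | cons h p ih =>
    rename_i a b c
    intro ha hu
    refine ih (fun w hw => ha w (by simp [hw])) (comp_step hu h ?_)
    intro hb
    refine ha b (by simp) ⟨hb, ?_⟩
    rintro rfl
    exact hx _ hu h

theorem sep_full {V : Type*} {G : SimpleGraph V} {S : Set V} {s t x : V}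
    (hS : IsMinimalSep G s t S) (hx : x ∈ S) : ∃ a ∈ CompOf G S s, G.Adj a x := by
  by_contra hcon
  push Not at hcon
  obtain ⟨⟨hs, ht, hsep⟩, hmin⟩ := hS
  refine hmin (S \ {x}) ⟨Set.diff_subset, fun h => (h hx).2 rfl⟩ ⟨fun h => hs h.1, fun h => ht h.1, ?_⟩
  intro p
  by_contra hp
  push Not at hp
  have := sep_full_aux hcon p hp ⟨Walk.nil, by intro w hw; simp at hw; subst hw; exact hs⟩
  obtain ⟨q, hq⟩ := this
  obtain ⟨w, hw, hwS⟩ := hsep q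
  exact hq w hw hwS

theorem isSep_symm {V : Type*} {G : SimpleGraph V} {S : Set V} {s t : V}
    (h : IsSep G s t S) : IsSep G t s S := by
  refine ⟨h.2.1, h.1, fun p => ?_⟩
  obtain ⟨w, hw, hwS⟩ := h.2.2 p.reverse
  exact ⟨w, by simpa using hw, hwS⟩

theorem isMinimalSep_symm {V : Type*} {G : SimpleGraph V} {S : Set V} {s t : V}
    (h : IsMinimalSep G s t S) : IsMinimalSep G t s S :=
  ⟨isSep_symm h.1, fun S' h' h'' => h.2 S' h' (isSep_symm h'')⟩

theorem comp_path {V : Type*} {G : SimpleGraph V} {S : Set V} {s t x y : V}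
    (hS : IsMinimalSep G s t S) (hx : x ∈ S) (hy : y ∈ S) (hxy : x ≠ y) :
    ∃ (p : ℕ) (f : ℕ → V), f 0 = x ∧ f p = y ∧
      (∀ i, 0 < i → i < p → f i ∈ CompOf G S s) ∧
      (∀ i j, i < j → j ≤ p → (G.Adj (f i) (f j) ↔ j = i + 1) ∧ f i ≠ f j) := by
  let C := CompOf G S s
  let H : SimpleGraph V :=
    { Adj := fun a b => G.Adj a b ∧ (a ∈ C ∨ a = x ∨ a = y) ∧ (b ∈ C ∨ b = x ∨ b = y)
      symm := ⟨fun a b h => ⟨h.1.symm, h.2.2, h.2.1⟩⟩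
      loopless := ⟨fun a h => G.loopless.irrefl a h.1⟩ }
  refine induced_path_aux G H C x y (fun a b => Iff.rfl) hxy ?_
  obtain ⟨a, ha, hax⟩ := sep_full hS hx
  obtain ⟨b, hb, hby⟩ := sep_full hS hy
  have hH : ∀ a b, a ∈ CompOf G S s → b ∈ CompOf G S s → G.Adj a b → H.Adj a b :=
    fun a b ha hb h => ⟨h, Or.inl ha, Or.inl hb⟩
  have h1 : H.Adj a x := ⟨hax, Or.inl ha, Or.inr (Or.inl rfl)⟩
  have h2 : H.Adj b y := ⟨hby, Or.inl hb, Or.inr (Or.inr rfl)⟩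
  exact h1.symm.reachable.trans ((comp_reach hS.1.1 hH ha).symm.trans
    ((comp_reach hS.1.1 hH hb).trans h2.reachable))

theorem cycle_of_fun {V : Type*} {G : SimpleGraph V} (n : ℕ) (hn : 3 ≤ n) (g : ℕ → V)
    (hg : ∀ i j, i < j → j < n →
      (G.Adj (g i) (g j) ↔ (j = i + 1 ∨ (i = 0 ∧ j + 1 = n))) ∧ g i ≠ g j) :
    Nonempty (cycleGraph n ↪g G) := by
  have hcyc : ∀ i j : Fin n, i < j →
      ((cycleGraph n).Adj i j ↔ (j.val = i.val + 1 ∨ (i.val = 0 ∧ j.val + 1 = n))) := by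
    intro i j hij
    have hij' : i.val < j.val := hij
    rw [cycleGraph_adj']
    have e1 : (i - j).val = n - (j.val - i.val) := by
      rw [Fin.sub_def]
      have : n - j.val + i.val < n := by omega
      simp only [Nat.mod_eq_of_lt this]; omega
    have e2 : (j - i).val = j.val - i.val := Fin.sub_val_of_le hij.le
    rw [e1, e2]
    have := j.isLt
    omega
  refine ⟨⟨⟨fun i => g i.val, ?_⟩, ?_⟩⟩
  · intro i j h
    rcases lt_trichotomy i j with hl | hl | hl
    · exact absurd h (hg i j hl j.isLt).2
    · exact hl
    · exact absurd h.symm (hg j i hl i.isLt).2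
  · intro i j
    change G.Adj (g i.val) (g j.val) ↔ _
    rcases lt_trichotomy i j with hl | hl | hl
    · rw [hcyc i j hl]; exact (hg i j hl j.isLt).1
    · subst hl; simp
    · rw [G.adj_comm, (cycleGraph n).adj_comm, hcyc j i hl]; exact (hg j i hl i.isLt).1

theorem path_len {V : Type*} {G : SimpleGraph V} (c : G.Coloring (Fin 2)) {x y : V}
    (hc : c x ≠ c y) (hn : ¬ G.Adj x y) {p : ℕ} {f : ℕ → V} (h0 : f 0 = x) (hp : f p = y)
    (hf : ∀ i j, i < j → j ≤ p → (G.Adj (f i) (f j) ↔ j = i + 1) ∧ f i ≠ f j) : 3 ≤ p := by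
  by_contra h
  have : p = 0 ∨ p = 1 ∨ p = 2 := by omega
  rcases this with rfl | rfl | rfl
  · exact hc (by rw [← h0, ← hp])
  · exact hn (by rw [← h0, ← hp]; exact ((hf 0 1 (by omega) (by omega)).1).2 rfl)
  · have h1 := c.valid (((hf 0 1 (by omega) (by omega)).1).2 rfl)
    have h2 := c.valid (((hf 1 2 (by omega) (by omega)).1).2 rfl)
    rw [h0] at h1
    rw [hp] at h2
    omega

theorem sep_adj {V : Type*} {G : SimpleGraph V} (c : G.Coloring (Fin 2))
    (hch : ChordalityAtMost G 5) {s t : V} {S : Set V} (hS : IsMinimalSep G s t S)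
    {x y : V} (hx : x ∈ S) (hy : y ∈ S) (hc : c x ≠ c y) : G.Adj x y := by
  by_contra hn
  have hxy : x ≠ y := fun h => hc (by rw [h])
  obtain ⟨p, f, f0, fp, fC, fA⟩ := comp_path hS hx hy hxy
  obtain ⟨q, f', f0', fp', fC', fA'⟩ := comp_path (isMinimalSep_symm hS) hx hy hxy
  have hp := path_len c hc hn f0 fp fA
  have hq := path_len c hc hn f0' fp' fA'
  have hdis : ∀ a ∈ CompOf G S s, a ∉ CompOf G S t := by
    rintro a ⟨w, hw⟩ ⟨w', hw'⟩
    obtain ⟨b, hb, hbS⟩ := hS.1.2.2 (w.append w'.reverse)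
    rw [Walk.mem_support_append_iff] at hb
    rcases hb with hb | hb
    · exact hw b hb hbS
    · exact hw' b (by simpa using hb) hbS
  have hnadj : ∀ a ∈ CompOf G S s, ∀ b ∈ CompOf G S t, ¬ G.Adj a b := fun a ha b hb h =>
    hdis b (comp_step ha h (comp_notMem hb)) hb
  refine (hch (p + q) (by omega)).elim' (cycle_of_fun (p + q) (by omega)
    (fun i => if i ≤ p then f i else f' (p + q - i)) ?_).some
  intro i j hij hj
  by_cases hjp : j ≤ p
  · have hip : i ≤ p := by omega
    simp only [hjp, hip, if_true]
    refine ⟨?_, (fA i j hij hjp).2⟩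
    rw [(fA i j hij hjp).1]
    omega
  · by_cases hip : i ≤ p
    · simp only [hjp, hip, if_true, if_false]
      by_cases hi0 : i = 0
      · subst hi0
        rw [f0, ← f0']
        have := fA' 0 (p + q - j) (by omega) (by omega)
        refine ⟨?_, this.2⟩
        rw [this.1]; omega
      by_cases hi1 : i = p
      · subst hi1
        rw [fp, ← fp']
        have := fA' (i + q - j) q (by omega) (by omega)
        refine ⟨?_, this.2.symm⟩
        rw [G.adj_comm, this.1]; omega
      have h1 := fC i (by omega) (by omega)
      have h2 := fC' (p + q - j) (by omega) (by omega)
      refine ⟨⟨fun h => absurd h (hnadj _ h1 _ h2), fun h => by omega⟩, ?_⟩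
      intro h
      exact hdis _ h1 (h ▸ h2)
    · simp only [hjp, hip, if_false]
      have := fA' (p + q - j) (p + q - i) (by omega) (by omega)
      refine ⟨?_, this.2.symm⟩
      rw [G.adj_comm, this.1]; omega

theorem stmt11 {V : Type*} [Fintype V] (G : SimpleGraph V)
    (hbip : G.Colorable 2) (hch : ChordalityAtMost G 5)
    (s t : V) (hst : s ≠ t) (hadj : ¬ G.Adj s t)
    (S : Set V) (hS : IsMinimalSep G s t S) :
    (∀ u ∈ S, ∀ v ∈ S, ¬ G.Adj u v) ∨ (G.induce S).Connected := by
  obtain ⟨c⟩ := hbip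
  by_cases h : ∀ u ∈ S, ∀ v ∈ S, ¬ G.Adj u v
  · exact Or.inl h
  right
  push Not at h
  obtain ⟨u, hu, v, hv, huv⟩ := h
  have hcuv := c.valid huv
  have key : ∀ w : S, (G.induce S).Reachable ⟨u, hu⟩ w := by
    rintro ⟨w, hw⟩
    have huv' : (G.induce S).Adj ⟨u, hu⟩ ⟨v, hv⟩ := huv
    by_cases h1 : c u = c w
    · have h2 : (G.induce S).Adj ⟨v, hv⟩ ⟨w, hw⟩ :=
        sep_adj c hch hS hv hw (fun h => hcuv (h1.trans h.symm))
      exact huv'.reachable.trans h2.reachable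
    · have h2 : (G.induce S).Adj ⟨u, hu⟩ ⟨w, hw⟩ := sep_adj c hch hS hu hw h1
      exact h2.reachable
  exact (connected_iff _).2 ⟨fun a b => (key a).symm.trans (key b), ⟨⟨u, hu⟩⟩⟩
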